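/- If every directed cycle of a finite digraph G has even length, then G has at least one kernel. -/

import Mathlib

/-- `K` is a kernel of the digraph on `Fin n` with adjacency `g`:
`K` is independent and every vertex outside `K` has an out-edge into `K`. -/
def IsKernel {n : ℕ} (g : Fin n → Fin n → ℝ) (K : Set (Fin n)) : Prop :=
  (∀ i ∈ K, ∀ j ∈ K, g i j = 0) ∧ ∀ i ∉ K, ∃ j ∈ K, g i j = 1

/-- `v : Fin k → Fin n` is a directed cycle of length `k ≥ 1` in `g`:
distinct vertices `v 0, …, v (k-1)` with an edge from each `v i` to `v (i+1)`
(indices mod `k`). -/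
def IsDirCycle {n : ℕ} (g : Fin n → Fin n → ℝ) (k : ℕ) (v : Fin k → Fin n) : Prop :=
  0 < k ∧ Function.Injective v ∧
    ∀ i : Fin k, g (v i) (v ⟨(i.1 + 1) % k, Nat.mod_lt _ i.pos⟩) = 1

/-- `b` can be reached from `a` by a walk of length `k` along `R`. -/
def IsWalkOfLength {α : Type*} (R : α → α → Prop) (k : ℕ) (a b : α) : Prop :=
  ∃ w : ℕ → α, w 0 = a ∧ w k = b ∧ ∀ i < k, R (w i) (w (i + 1))

namespace IsWalkOfLength

variable {α : Type*} {R R' : α → α → Prop} {a b c : α} {k l : ℕ}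

lemma zero (a : α) : IsWalkOfLength R 0 a a :=
  ⟨fun _ => a, rfl, rfl, fun i hi => absurd hi (Nat.not_lt_zero i)⟩

lemma single (h : R a b) : IsWalkOfLength R 1 a b := by
  refine ⟨fun i => if i = 0 then a else b, by simp, by simp, fun i hi => ?_⟩
  obtain rfl : i = 0 := by omega
  simpa using h

lemma mono (hR : ∀ x y, R x y → R' x y) (h : IsWalkOfLength R k a b) :
    IsWalkOfLength R' k a b := by
  obtain ⟨w, h0, hk, hw⟩ := h
  exact ⟨w, h0, hk, fun i hi => hR _ _ (hw i hi)⟩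

lemma segment {w : ℕ → α} (hw : ∀ i < k, R (w i) (w (i + 1))) {i j : ℕ} (hij : i ≤ j)
    (hj : j ≤ k) : IsWalkOfLength R (j - i) (w i) (w j) :=
  ⟨fun m => w (i + m), by simp, by simp [Nat.add_sub_cancel' hij],
    fun m hm => hw (i + m) (by omega)⟩

lemma trans (h₁ : IsWalkOfLength R k a b) (h₂ : IsWalkOfLength R l b c) :
    IsWalkOfLength R (k + l) a c := by
  obtain ⟨w, hw0, hwk, hw⟩ := h₁
  obtain ⟨u, hu0, hul, hu⟩ := h₂
  refine ⟨fun m => if m < k then w m else u (m - k), ?_, by simpa using hul, fun i hi => ?_⟩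
  · rcases Nat.eq_zero_or_pos k with rfl | hk
    · simp [hu0, ← hwk, hw0]
    · simp [hk, hw0]
  · rcases lt_trichotomy (i + 1) k with h | h | h
    · simpa [h, show i < k by omega] using hw i (by omega)
    · subst h
      simpa [hu0, ← hwk] using hw i (by omega)
    · have := hu (i - k) (by omega)
      rw [show i - k + 1 = i + 1 - k by omega] at this
      simpa [show ¬ i < k by omega, show ¬ i + 1 < k by omega] using this

lemma exists_step (h : IsWalkOfLength R k a c) (hac : a ≠ c) :
    ∃ b, R a b := by
  obtain ⟨w, rfl, rfl, hw⟩ := h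
  have hk : 0 < k := Nat.pos_of_ne_zero fun h => hac (by rw [h])
  exact ⟨w 1, hw 0 hk⟩

end IsWalkOfLength

/-- A closed walk of odd length contains a directed cycle of odd length. -/
lemma even_of_closed_walk {n : ℕ} {g : Fin n → Fin n → ℝ}
    (heven : ∀ (k : ℕ) (v : Fin k → Fin n), IsDirCycle g k v → Even k) (k : ℕ) (a : Fin n)
    (h : IsWalkOfLength (fun i j => g i j = 1) k a a) : Even k := by
  induction k using Nat.strong_induction_on generalizing a with
  | _ k ih =>
  obtain ⟨w, hw0, hwk, hw⟩ := h
  rcases Nat.eq_zero_or_pos k with rfl | hk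
  · exact Even.zero
  by_cases hinj : ∃ i j, i < j ∧ j < k ∧ w i = w j
  · obtain ⟨i, j, hij, hjk, hwij⟩ := hinj
    have inner := IsWalkOfLength.segment (R := fun i j => g i j = 1) hw hij.le hjk.le
    have before := IsWalkOfLength.segment (R := fun i j => g i j = 1) hw (Nat.zero_le i)
      (hij.trans hjk).le
    have after := IsWalkOfLength.segment (R := fun i j => g i j = 1) hw hjk.le le_rfl
    rw [hwij] at inner
    rw [hw0, hwij] at before
    rw [hwk] at after
    have outer := before.trans after
    have h₁ := ih _ (by omega) _ inner
    have h₂ := ih _ (by omega) _ outer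
    rw [Nat.even_iff] at *
    omega
  · refine heven k (fun i => w i) ⟨hk, fun i j hij => ?_, fun i => ?_⟩
    · by_contra hne
      rcases Nat.lt_or_gt_of_ne (Fin.val_ne_of_ne hne) with h | h
      · exact hinj ⟨i, j, h, j.2, hij⟩
      · exact hinj ⟨j, i, h, i.2, hij.symm⟩
    · have := hw i i.2
      rcases Nat.lt_or_ge (i.1 + 1) k with h | h
      · simpa [Nat.mod_eq_of_lt h] using this
      · have hik : i.1 + 1 = k := by omega
        simpa [hik, hwk, hw0] using this

/-- Some vertex `v` of a nonempty finite set lies in a terminal strong component: every vertex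
reachable from `v` inside the set can reach `v` back. -/
lemma exists_mem_terminal_component {α : Type*} (R : α → α → Prop) (S : Finset α)
    (hS : S.Nonempty) (hR : ∀ x y, R x y → y ∈ S) :
    ∃ v ∈ S, ∀ k u, IsWalkOfLength R k v u → ∃ l, IsWalkOfLength R l u v := by
  classical
  let reach (v : α) : Finset α := {u ∈ S | ∃ k, IsWalkOfLength R k v u}
  obtain ⟨v, hv, hmin⟩ := S.exists_min_image (fun v => (reach v).card) hS
  refine ⟨v, hv, fun k u hu => ?_⟩
  have huS : u ∈ S := by
    obtain ⟨w, rfl, rfl, hw⟩ := hu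
    cases k with
    | zero => exact hv
    | succ k => exact hR _ _ (hw k (Nat.lt_succ_self k))
  have hsub : reach u ⊆ reach v := by
    intro x hx
    obtain ⟨hxS, l, hl⟩ := Finset.mem_filter.1 hx
    exact Finset.mem_filter.2 ⟨hxS, _, hu.trans hl⟩
  have hvu : v ∈ reach u := by
    rw [Finset.eq_of_subset_of_card_le hsub (hmin u huS)]
    exact Finset.mem_filter.2 ⟨hv, 0, .zero v⟩
  exact (Finset.mem_filter.1 hvu).2

/-- If all closed walks have even length, every finite set of vertices induces a subdigraph
with a kernel. -/
lemma exists_kernel_of_even_closed_walks {α : Type*} (R : α → α → Prop)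
    (heven : ∀ k a, IsWalkOfLength R k a a → Even k) (S : Finset α) :
    ∃ K ⊆ S, (∀ a ∈ K, ∀ b ∈ K, ¬ R a b) ∧ ∀ a ∈ S, a ∉ K → ∃ b ∈ K, R a b := by
  classical
  induction S using Finset.strongInduction with
  | _ S ih =>
  rcases S.eq_empty_or_nonempty with rfl | hS
  · exact ⟨∅, by simp⟩
  let r (x y : α) : Prop := R x y ∧ y ∈ S
  obtain ⟨v, hv, hback⟩ := exists_mem_terminal_component r S hS fun _ _ h => h.2
  let A : Finset α := {u ∈ S | ∃ k, Even k ∧ IsWalkOfLength r k v u}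
  let T : Finset α := {u ∈ S | (¬ ∃ k, IsWalkOfLength r k v u) ∧ ∀ b ∈ A, ¬ R u b}
  have hvT : v ∉ T := fun h => (Finset.mem_filter.1 h).2.1 ⟨0, .zero v⟩
  have hTS : T ⊆ S := Finset.filter_subset _ _
  obtain ⟨K, hKT, hKind, hKdom⟩ := ih T ⟨hTS, fun h => hvT (h hv)⟩
  have even_closed {k a} (h : IsWalkOfLength r k a a) : Even k :=
    heven k a (h.mono fun _ _ h => h.1)
  refine ⟨A ∪ K, Finset.union_subset (Finset.filter_subset _ _) (hKT.trans hTS), ?_, ?_⟩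
  · intro a ha b hb hab
    rcases Finset.mem_union.1 ha with ha | ha
    · obtain ⟨-, k, hk, hwk⟩ := Finset.mem_filter.1 ha
      rcases Finset.mem_union.1 hb with hb | hb
      · obtain ⟨hbS, l, hl, hwl⟩ := Finset.mem_filter.1 hb
        obtain ⟨m, hm⟩ := hback l b hwl
        have h₁ := even_closed (hwl.trans hm)
        have h₂ := even_closed ((hwk.trans (.single ⟨hab, hbS⟩)).trans hm)
        rw [Nat.even_iff] at *
        omega
      · obtain ⟨hbS, hb', -⟩ := Finset.mem_filter.1 (hKT hb)
        exact hb' ⟨_, hwk.trans (.single ⟨hab, hbS⟩)⟩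
    · rcases Finset.mem_union.1 hb with hb | hb
      · exact (Finset.mem_filter.1 (hKT ha)).2.2 b hb hab
      · exact hKind a ha b hb hab
  · intro a haS ha
    rw [Finset.mem_union, not_or] at ha
    by_cases hreach : ∃ k, IsWalkOfLength r k v a
    · obtain ⟨k, hk⟩ := hreach
      have hav : a ≠ v := by
        rintro rfl
        exact ha.1 (Finset.mem_filter.2 ⟨haS, 0, Even.zero, .zero a⟩)
      have hodd : ¬ Even k := fun h => ha.1 (Finset.mem_filter.2 ⟨haS, k, h, hk⟩)
      obtain ⟨l, hl⟩ := hback k a hk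
      obtain ⟨b, hab⟩ := hl.exists_step hav
      refine ⟨b, Finset.mem_union_left _ (Finset.mem_filter.2 ⟨hab.2, k + 1, ?_, ?_⟩), hab.1⟩
      · exact Nat.even_add_one.2 hodd
      · exact hk.trans (.single hab)
    · by_cases hA : ∃ b ∈ A, R a b
      · obtain ⟨b, hb, hab⟩ := hA
        exact ⟨b, Finset.mem_union_left _ hb, hab⟩
      · obtain ⟨b, hb, hab⟩ := hKdom a
          (Finset.mem_filter.2 ⟨haS, hreach, fun b hb hab => hA ⟨b, hb, hab⟩⟩) ha.2
        exact ⟨b, Finset.mem_union_right _ hb, hab⟩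

/-- If every directed cycle of a finite digraph has even length,
then the digraph has at least one kernel. -/
theorem kernel_exists_of_all_cycles_even
    {n : ℕ} (g : Fin n → Fin n → ℝ)
    (hg01 : ∀ i j, g i j = 0 ∨ g i j = 1) (hgdiag : ∀ i, g i i = 0)
    (heven : ∀ (k : ℕ) (v : Fin k → Fin n), IsDirCycle g k v → Even k) :
    ∃ K : Set (Fin n), IsKernel g K := by
  obtain ⟨K, -, hind, hdom⟩ := exists_kernel_of_even_closed_walks (fun i j => g i j = 1)
    (even_of_closed_walk heven) Finset.univ
  exact ⟨K, fun i hi j hj => (hg01 i j).resolve_right (hind i hi j hj),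
    fun i hi => hdom i (Finset.mem_univ i) hi⟩
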